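/- arXiv:1205.0642 — 5 statements merged into one kernel-verified Lean document; each statement's English description precedes it below -/
import Mathlib

section
/- Let G be a finite group of order n ≥ 2 and let p be the smallest prime dividing n. Then the number of chains of subgroups 1 = K₀ < K₁ < ⋯ < K_m = G such that for every j < m there exists a simple minimal normal subgroup S of G with K_j ∩ S = 1 and K_{j+1} = K_j⋅S (so that each K_j is an internal direct product of simple minimal normal subgroups of G) is at most n · p^{(1/2)(log_p n)²} = n^{(1/2) log_p n + 1}. -/
/-- A minimal normal subgroup: a nontrivial normal subgroup that does not
properly contain any nontrivial normal subgroup. -/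
def IsMinimalNormal {G : Type*} [Group G] (N : Subgroup G) : Prop :=
  N.Normal ∧ N ≠ ⊥ ∧ ∀ M : Subgroup G, M.Normal → M ≠ ⊥ → M ≤ N → M = N

/-- `K'` is the internal direct product of `K` and a simple minimal normal subgroup. -/
def SimpleMinimalNormalStep {G : Type*} [Group G] (K K' : Subgroup G) : Prop :=
  K < K' ∧ ∃ S : Subgroup G,
    IsMinimalNormal S ∧ IsSimpleGroup S ∧ K ⊓ S = ⊥ ∧ K' = K ⊔ S

/-- The chains of simple minimal normal steps leading from `K` to the whole group. -/
def simpleMinimalNormalChains {G : Type*} [Group G] (K : Subgroup G) : Set (List (Subgroup G)) :=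
  {l | l.head? = some K ∧ l.getLast? = some ⊤ ∧ l.IsChain SimpleMinimalNormalStep}

namespace SimpleMinimalNormalStep

variable {G : Type*} [Group G] {K K' K'' : Subgroup G}

theorem normal (hK : K.Normal) (h : SimpleMinimalNormalStep K K') : K'.Normal := by
  obtain ⟨-, S, ⟨hS, -⟩, -, -, rfl⟩ := h
  exact Subgroup.sup_normal K S

theorem le_or_inf_eq (h : SimpleMinimalNormalStep K K') (hK : K.Normal)
    (hN : K''.Normal) (hle : K ≤ K'') : K' ≤ K'' ∨ K' ⊓ K'' = K := by
  obtain ⟨-, S, ⟨hS, -, hmin⟩, -, -, rfl⟩ := h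
  by_cases hbot : S ⊓ K'' = ⊥
  · right
    apply le_antisymm _ (le_inf le_sup_left hle)
    rintro x ⟨hx, hx''⟩
    obtain ⟨k, hk, s, hs, rfl⟩ := Subgroup.mem_sup_of_normal_left.mp hx
    have hsK : s ∈ S ⊓ K'' := ⟨hs, (Subgroup.mul_mem_cancel_left K'' (hle hk)).mp hx''⟩
    rw [hbot, Subgroup.mem_bot] at hsK
    simpa [hsK] using hk
  · left
    have := hmin (S ⊓ K'') (Subgroup.normal_inf_normal S K'') hbot inf_le_left
    exact sup_le hle (inf_eq_left.mp this)

theorem inf_eq (h' : SimpleMinimalNormalStep K K') (h'' : SimpleMinimalNormalStep K K'')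
    (hK : K.Normal) (hne : K' ≠ K'') : K' ⊓ K'' = K := by
  rcases h'.le_or_inf_eq hK (h''.normal hK) h''.1.le with h1 | h1
  · rcases h''.le_or_inf_eq hK (h'.normal hK) h'.1.le with h2 | h2
    · exact absurd (le_antisymm h1 h2) hne
    · rwa [inf_comm]
  · exact h1

theorem ncard_le_index [Finite G] (hK : K.Normal) :
    {K' | SimpleMinimalNormalStep K K'}.ncard ≤ K.index := by
  have hex : ∀ K' : {K' | SimpleMinimalNormalStep K K'}, ∃ x ∈ K'.1, x ∉ K :=
    fun K' => SetLike.exists_of_lt K'.2.1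
  choose x hx hxK using hex
  rw [← Nat.card_coe_set_eq, Subgroup.index]
  refine Nat.card_le_card_of_injective (fun K' => (x K' : G ⧸ K)) fun K' K'' heq => ?_
  by_contra hne
  have hmem : (x K')⁻¹ * x K'' ∈ K := QuotientGroup.eq.mp heq
  apply hxK K''
  rw [← K'.2.inf_eq K''.2 hK (fun h => hne (Subtype.ext h))]
  exact ⟨(Subgroup.mul_mem_cancel_left K'.1 (inv_mem (hx K'))).mp (K'.2.1.le hmem), hx K''⟩

end SimpleMinimalNormalStep

theorem simpleMinimalNormalChains_top {G : Type*} [Group G] :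
    simpleMinimalNormalChains (⊤ : Subgroup G) ⊆ {[⊤]} := by
  rintro (_ | ⟨a, _ | ⟨b, l⟩⟩) ⟨hhead, -, hchain⟩
  · simp at hhead
  · simpa using hhead
  · obtain rfl : a = ⊤ := by simpa using hhead
    exact absurd (List.isChain_cons_cons.mp hchain).1.1 not_top_lt

theorem simpleMinimalNormalChains_subset {G : Type*} [Group G] {K : Subgroup G} (hK : K ≠ ⊤) :
    simpleMinimalNormalChains K ⊆
      (K :: ·) '' ⋃ K' ∈ {K' | SimpleMinimalNormalStep K K'}, simpleMinimalNormalChains K' := by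
  rintro (_ | ⟨a, _ | ⟨b, l⟩⟩) ⟨hhead, hlast, hchain⟩
  · simp at hhead
  · simp_all
  · obtain rfl : a = K := by simpa using hhead
    rw [List.isChain_cons_cons] at hchain
    refine ⟨b :: l, ?_, rfl⟩
    simp only [Set.mem_iUnion]
    exact ⟨b, hchain.1, rfl, by simpa using hlast, hchain.2⟩

theorem Set.ncard_biUnion_le_of_forall {α β : Type*} {s : Set α} (hs : s.Finite) (f : α → Set β)
    {M : ℝ} (hf : ∀ a ∈ s, (f a).Finite ∧ ((f a).ncard : ℝ) ≤ M) :
    ((⋃ a ∈ s, f a).ncard : ℝ) ≤ s.ncard * M := by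
  induction s, hs using Set.Finite.induction_on with
  | empty => simp
  | @insert a s ha hs ih =>
    rw [Set.biUnion_insert, Set.ncard_insert_of_notMem ha hs]
    have h1 := ih fun b hb => hf b (Set.mem_insert_of_mem a hb)
    have h2 := (hf a (Set.mem_insert a s)).2
    have h3 : ((f a ∪ ⋃ b ∈ s, f b).ncard : ℝ) ≤ (f a).ncard + (⋃ b ∈ s, f b).ncard := by
      exact_mod_cast Set.ncard_union_le _ _
    push_cast
    linarith

theorem mul_rpow_logb_le {p r s : ℝ} (hp : 1 < p) (hs : 1 ≤ s) (hsr : p * s ≤ r) :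
    r * p ^ ((Real.logb p s ^ 2 + Real.logb p s) / 2) ≤
      p ^ ((Real.logb p r ^ 2 + Real.logb p r) / 2) := by
  have hp0 : 0 < p := by linarith
  have hr : 0 < r := by nlinarith
  have hLs : 0 ≤ Real.logb p s := Real.logb_nonneg hp hs
  have hL : 1 + Real.logb p s ≤ Real.logb p r := by
    have := Real.logb_le_logb_of_le hp (by positivity) hsr
    rwa [Real.logb_mul hp0.ne' (by linarith), Real.logb_self_eq_one hp] at this
  nth_rewrite 1 [← Real.rpow_logb hp0 hp.ne' hr]
  rw [← Real.rpow_add hp0]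
  apply Real.rpow_le_rpow_of_exponent_le hp.le
  nlinarith

theorem simpleMinimalNormalChains_finite_and_ncard_le {G : Type*} [Group G] [Finite G] {p : ℕ}
    (hp : p.Prime) (hpmin : ∀ q : ℕ, q.Prime → q ∣ Nat.card G → p ≤ q)
    (K : Subgroup G) (hK : K.Normal) :
    (simpleMinimalNormalChains K).Finite ∧ ((simpleMinimalNormalChains K).ncard : ℝ) ≤
      (p : ℝ) ^ ((Real.logb p K.index ^ 2 + Real.logb p K.index) / 2) := by
  induction K using WellFoundedGT.induction with
  | ind K ih =>
  by_cases hKtop : K = ⊤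
  · subst hKtop
    have hfin := Set.finite_singleton [(⊤ : Subgroup G)]
    refine ⟨hfin.subset simpleMinimalNormalChains_top, ?_⟩
    have := Set.ncard_le_ncard simpleMinimalNormalChains_top hfin
    rw [Set.ncard_singleton] at this
    simpa using this
  have hstep : ∀ K' ∈ {K' | SimpleMinimalNormalStep K K'},
      (simpleMinimalNormalChains K').Finite ∧ ((simpleMinimalNormalChains K').ncard : ℝ) ≤
        (p : ℝ) ^ ((Real.logb p K.index ^ 2 + Real.logb p K.index) / 2) / K.index := by
    intro K' h
    obtain ⟨hfin, hle⟩ := ih K' h.1 (h.normal hK)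
    refine ⟨hfin, hle.trans ?_⟩
    have hpos : 0 < K.index := Nat.pos_of_ne_zero Subgroup.index_ne_zero_of_finite
    have hpos' : 1 ≤ K'.index := Nat.one_le_iff_ne_zero.mpr Subgroup.index_ne_zero_of_finite
    have hmul : K.relIndex K' * K'.index = K.index := Subgroup.relIndex_mul_index h.1.le
    have hne : K.relIndex K' ≠ 1 := fun h1 => h.1.not_ge (Subgroup.relIndex_eq_one.mp h1)
    have hprel : p ≤ K.relIndex K' := by
      refine (hpmin _ (Nat.minFac_prime hne) ?_).trans
        (Nat.minFac_le (Nat.pos_of_ne_zero fun h0 => by simp [h0] at hmul; omega))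
      exact (Nat.minFac_dvd _).trans ((Dvd.intro _ hmul).trans K.index_dvd_card)
    rw [le_div_iff₀ (by exact_mod_cast hpos), mul_comm]
    refine mul_rpow_logb_le (by exact_mod_cast hp.one_lt) (by exact_mod_cast hpos') ?_
    exact_mod_cast hmul ▸ Nat.mul_le_mul_right K'.index hprel
  have hsteps : {K' | SimpleMinimalNormalStep K K'}.Finite := Set.toFinite _
  have hunion := hsteps.biUnion fun K' h => (hstep K' h).1
  refine ⟨(hunion.image _).subset (simpleMinimalNormalChains_subset hKtop), ?_⟩
  have hcard := (Set.ncard_le_ncard (simpleMinimalNormalChains_subset hKtop)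
    (hunion.image _)).trans (Set.ncard_image_le hunion)
  have hbound := Set.ncard_biUnion_le_of_forall hsteps _ hstep
  have hindex : (({K' | SimpleMinimalNormalStep K K'}.ncard : ℕ) : ℝ) ≤ K.index := by
    exact_mod_cast SimpleMinimalNormalStep.ncard_le_index hK
  have hpos : (0 : ℝ) < K.index := by
    exact_mod_cast Nat.pos_of_ne_zero Subgroup.index_ne_zero_of_finite
  calc ((simpleMinimalNormalChains K).ncard : ℝ)
      ≤ _ := Nat.cast_le.mpr hcard
    _ ≤ _ := hbound
    _ ≤ K.index * _ := mul_le_mul_of_nonneg_right hindex (by positivity)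
    _ = _ := mul_div_cancel₀ _ hpos.ne'

/-- Let `G` be a finite group of order `n ≥ 2` and `p` the smallest prime dividing `n`.
The number of chains of subgroups `1 = K₀ < K₁ < ⋯ < K_m = G` (encoded as lists)
in which each successive subgroup is obtained from the previous one as the internal
direct product `K_{j+1} = K_j ⋅ S` with a simple minimal normal subgroup `S` of `G`
satisfying `K_j ∩ S = 1` is at most `n · p^{(1/2)(log_p n)²} = n^{(1/2) log_p n + 1}`. -/
theorem num_chains_of_products_of_simple_minimal_normals_le
    {G : Type*} [Group G] [Fintype G]
    (n p : ℕ) (hn : Fintype.card G = n) (hn2 : 2 ≤ n)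
    (hp : p.Prime) (hpn : p ∣ n)
    (hpmin : ∀ q : ℕ, q.Prime → q ∣ n → p ≤ q) :
    ({l : List (Subgroup G) |
        l.head? = some ⊥ ∧ l.getLast? = some ⊤ ∧
        l.Chain' (fun K K' => K < K' ∧ ∃ S : Subgroup G,
          IsMinimalNormal S ∧ IsSimpleGroup S ∧ K ⊓ S = ⊥ ∧ K' = K ⊔ S)}.ncard : ℝ)
      ≤ (n : ℝ) * (p : ℝ) ^ ((1 / 2 : ℝ) * (Real.log n / Real.log p) ^ 2) ∧
    (n : ℝ) * (p : ℝ) ^ ((1 / 2 : ℝ) * (Real.log n / Real.log p) ^ 2)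
      = (n : ℝ) ^ ((1 / 2 : ℝ) * (Real.log n / Real.log p) + 1) := by
  have hp1 : (1 : ℝ) < p := by exact_mod_cast hp.one_lt
  have hp0 : (0 : ℝ) < p := by linarith
  have hn0 : (0 : ℝ) < n := by
    have : 0 < n := by omega
    exact_mod_cast this
  have hcard : Nat.card G = n := by rw [Nat.card_eq_fintype_card, hn]
  have hpow : (p : ℝ) ^ (Real.log n / Real.log p) = n := Real.rpow_logb hp0 hp1.ne' hn0
  have hL : 0 ≤ Real.log n / Real.log p :=
    Real.logb_nonneg hp1 (by exact_mod_cast (by omega : 1 ≤ n))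
  constructor
  · have hbound := (simpleMinimalNormalChains_finite_and_ncard_le hp (hcard ▸ hpmin)
      (⊥ : Subgroup G) inferInstance).2
    rw [Subgroup.index_bot, hcard, Real.logb] at hbound
    refine hbound.trans ?_
    nth_rewrite 3 [← hpow]
    rw [← Real.rpow_add hp0]
    apply Real.rpow_le_rpow_of_exponent_le hp1.le
    nlinarith
  · rw [Real.rpow_add hn0, Real.rpow_one, mul_comm]
    congr 1
    nth_rewrite 2 [← hpow]
    rw [← Real.rpow_mul hp0.le]
    ring_nf
end

section
/- Let c₁ and c₂ be positive real constants and let n > 1 be a real number. Then for every real number p with 2 ≤ p and p ≤ c₁ ln n / (c₂ ln² p), one has c₁ ln n / ln p + c₂ p ≤ c₁ ln n / ln 2 + 2c₂ (that is, c₁ log_p n + c₂ p ≤ c₁ log₂ n + O(1) on this range). -/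
/-- For positive constants `c₁, c₂` and `n > 1`: for every `p` with `2 ≤ p` and
`p ≤ c₁ ln n / (c₂ ln² p)`, one has `c₁ log_p n + c₂ p ≤ c₁ log₂ n + 2 c₂`. -/
theorem small_p_bound (c₁ c₂ n : ℝ) (hc₁ : 0 < c₁) (hc₂ : 0 < c₂) (hn : 1 < n) :
    ∀ p : ℝ, 2 ≤ p → p ≤ c₁ * Real.log n / (c₂ * (Real.log p) ^ 2) →
      c₁ * Real.log n / Real.log p + c₂ * p
        ≤ c₁ * Real.log n / Real.log 2 + 2 * c₂ := by
  intro p hp h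
  have hp0 : 0 < p := by linarith
  have hlog2 : 0 < Real.log 2 := Real.log_pos one_lt_two
  have hle : Real.log 2 ≤ Real.log p := Real.log_le_log two_pos hp
  have hlogp : 0 < Real.log p := hlog2.trans_le hle
  have hlog : p - 2 ≤ p * (Real.log p - Real.log 2) := by
    have h1 := Real.one_sub_inv_le_log_of_pos (div_pos hp0 two_pos)
    rw [Real.log_div hp0.ne' two_ne_zero, inv_div] at h1
    calc p - 2 = p * (1 - 2 / p) := by field_simp
      _ ≤ _ := by gcongr
  rw [le_div_iff₀ (by positivity)] at h
  generalize c₁ * Real.log n = A at h ⊢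
  generalize Real.log p = L at *
  generalize Real.log 2 = l at *
  have hd : 0 ≤ L - l := sub_nonneg.2 hle
  have key : c₂ * (p - 2) ≤ A / l - A / L :=
    calc c₂ * (p - 2) ≤ c₂ * (p * (L - l)) := by gcongr
      _ = p * (c₂ * (l * L)) * (L - l) / (l * L) := by field_simp
      _ ≤ p * (c₂ * L ^ 2) * (L - l) / (l * L) := by
        rw [sq]
        gcongr
      _ ≤ A * (L - l) / (l * L) := by gcongr
      _ = A / l - A / L := by field_simp
  linarith
end

section
/- Let G be a finite solvable group whose order has the prime factorization n = ∏_{i=1}^ℓ pᵢ^{eᵢ}, and let {Pᵢ : 1 ≤ i ≤ ℓ} be a Sylow basis of G. Then for every subset I ⊆ {1, …, ℓ}, the product set ∏_{i∈I} Pᵢ (the set of all products of one element from each Pᵢ with i ∈ I, taken in increasing order of i) is a subgroup of G of order ∏_{i∈I} pᵢ^{eᵢ}. -/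
open Pointwise

/-- If two subgroups permute as sets and intersect trivially, their product set is a subgroup,
whose order is the product of the two orders. -/
theorem Subgroup.exists_coe_eq_mul_of_commute_of_disjoint {G : Type*} [Group G]
    {A B : Subgroup G} (hAB : Commute (A : Set G) (B : Set G)) (hd : Disjoint A B) :
    ∃ H : Subgroup G, (H : Set G) = (A : Set G) * (B : Set G) ∧
      Nat.card H = Nat.card A * Nat.card B := by
  have hmul : (A : Set G) * B * (A * B) = A * B := by
    rw [hAB.symm.mul_mul_mul_comm, coe_mul_coe, coe_mul_coe]
  refine ⟨{ carrier := (A : Set G) * B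
            mul_mem' := fun ha hb => hmul ▸ Set.mul_mem_mul ha hb
            one_mem' := ⟨1, A.one_mem, 1, B.one_mem, one_mul 1⟩
            inv_mem' := ?_ }, rfl, ?_⟩
  · rintro _ ⟨a, ha, b, hb, rfl⟩
    rw [hAB.eq]
    exact ⟨b⁻¹, B.inv_mem hb, a⁻¹, A.inv_mem ha, (mul_inv_rev a b).symm⟩
  · rw [← Nat.card_prod]
    refine (Nat.card_congr (Equiv.ofBijective
      (fun x : A × B => ⟨(x.1 : G) * x.2, Set.mul_mem_mul x.1.2 x.2.2⟩) ⟨?_, ?_⟩)).symm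
    · intro x y hxy
      exact mul_injective_of_disjoint hd (congrArg Subtype.val hxy)
    · rintro ⟨_, a, ha, b, hb, rfl⟩
      exact ⟨(⟨a, ha⟩, ⟨b, hb⟩), rfl⟩

/-- The product, along a list, of permuting subgroups of pairwise coprime orders is a subgroup,
whose order is the product of their orders. -/
theorem Subgroup.exists_coe_eq_list_prod {G ι : Type*} [Group G] (P : ι → Subgroup G)
    (hcomm : ∀ i j, Commute (P i : Set G) (P j : Set G)) (l : List ι)
    (hl : l.Pairwise fun i j => (Nat.card (P i)).Coprime (Nat.card (P j))) :
    ∃ H : Subgroup G, (H : Set G) = (l.map fun i => (P i : Set G)).prod ∧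
      Nat.card H = (l.map fun i => Nat.card (P i)).prod := by
  induction l with
  | nil => exact ⟨⊥, by simp [Set.singleton_one]⟩
  | cons i l ih =>
    obtain ⟨hi, hl⟩ := List.pairwise_cons.mp hl
    obtain ⟨H, hH, hc⟩ := ih hl
    have hiH : Commute (P i : Set G) (H : Set G) := by
      rw [hH]
      refine Commute.list_prod_right _ _ fun x hx => ?_
      obtain ⟨j, -, rfl⟩ := List.mem_map.mp hx
      exact hcomm i j
    have hcop : (Nat.card (P i)).Coprime (Nat.card H) := by
      rw [hc]
      refine Nat.coprime_list_prod_right_iff.mpr fun n hn => ?_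
      obtain ⟨j, hj, rfl⟩ := List.mem_map.mp hn
      exact hi j hj
    obtain ⟨K, hK, hKc⟩ := exists_coe_eq_mul_of_commute_of_disjoint hiH
      (disjoint_of_coprime_natCard hcop)
    exact ⟨K, by rw [hK, hH, List.map_cons, List.prod_cons],
      by rw [hKc, hc, List.map_cons, List.prod_cons]⟩

/-- Let `G` be a finite solvable group whose order has prime factorization
`n = ∏ᵢ pᵢ^eᵢ`, and let `{Pᵢ}` be a Sylow basis of `G` (each `Pᵢ` is a Sylow
`pᵢ`-subgroup, i.e. a subgroup of order `pᵢ^eᵢ`, and `Pᵢ Pⱼ = Pⱼ Pᵢ` as sets).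
Then for every subset `I ⊆ {1, …, ℓ}`, the product set `∏_{i ∈ I} Pᵢ` (taken in
increasing order of `i`) is a subgroup of `G` of order `∏_{i ∈ I} pᵢ^eᵢ`. -/
theorem sylow_basis_partial_product_subgroup {G : Type*} [Group G] [Fintype G]
    (ℓ : ℕ) (p e : Fin ℓ → ℕ)
    (hprime : ∀ i, (p i).Prime)
    (hdistinct : Function.Injective p)
    (hepos : ∀ i, 0 < e i)
    (hcard : Fintype.card G = ∏ i, p i ^ e i)
    (hsolv : IsSolvable G)
    (P : Fin ℓ → Subgroup G)
    (hP : ∀ i, Nat.card (P i) = p i ^ e i)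
    (hcomm : ∀ i j, (P i : Set G) * (P j : Set G) = (P j : Set G) * (P i : Set G)) :
    ∀ I : Finset (Fin ℓ), ∃ H : Subgroup G,
      (H : Set G) = ((I.sort (· ≤ ·)).map (fun i => (P i : Set G))).prod ∧
      Nat.card H = ∏ i ∈ I, p i ^ e i := by
  intro I
  obtain ⟨H, hH, hc⟩ := Subgroup.exists_coe_eq_list_prod P hcomm (I.sort (· ≤ ·))
    ((I.sort_nodup (· ≤ ·)).imp fun {i j} hij => by
      rw [hP, hP]
      exact Nat.coprime_pow_primes _ _ (hprime i) (hprime j) (hdistinct.ne hij))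
  refine ⟨H, hH, ?_⟩
  rw [hc, ← List.prod_toFinset _ (I.sort_nodup (· ≤ ·)), Finset.sort_toFinset]
  exact Finset.prod_congr rfl fun i _ => hP i
end

section
/- Let G be a finite solvable group whose order has the prime factorization n = ∏_{i=1}^ℓ pᵢ^{eᵢ}, and let {Pᵢ : 1 ≤ i ≤ ℓ} be a Sylow basis of G. Then every element x ∈ G is uniquely expressible as a product x = x₁ x₂ ⋯ x_ℓ where xᵢ ∈ Pᵢ for each i. -/
open Pointwise

/-- Two permuting subgroups have a product set that is itself a subgroup. -/
theorem Subgroup.exists_coe_eq_mul_of_commute {G : Type*} [Group G] (H K : Subgroup G)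
    (h : Commute (H : Set G) (K : Set G)) :
    ∃ L : Subgroup G, (L : Set G) = (H : Set G) * (K : Set G) := by
  refine ⟨{ carrier := (H : Set G) * (K : Set G), mul_mem' := ?_, one_mem' := ?_, inv_mem' := ?_ },
    rfl⟩
  · intro a b ha hb
    have hmul : (H : Set G) * K * (H * K) = H * K := by
      rw [h.symm.mul_mul_mul_comm, coe_mul_coe, coe_mul_coe]
    rw [← hmul]
    exact Set.mul_mem_mul ha hb
  · exact ⟨1, H.one_mem, 1, K.one_mem, one_mul 1⟩
  · rintro _ ⟨a, ha, b, hb, rfl⟩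
    change (a * b)⁻¹ ∈ (H : Set G) * K
    rw [h.eq, mul_inv_rev]
    exact Set.mul_mem_mul (K.inv_mem hb) (H.inv_mem ha)

/-- The product set of a list of pairwise permuting subgroups is a subgroup containing
each of them. -/
theorem Subgroup.exists_coe_eq_list_prod_of_commute {G ι : Type*} [Group G] (P : ι → Subgroup G)
    (hcomm : ∀ i j, Commute (P i : Set G) (P j : Set G)) (l : List ι) :
    ∃ H : Subgroup G, (H : Set G) = (l.map fun i => (P i : Set G)).prod ∧ ∀ i ∈ l, P i ≤ H := by
  induction l with
  | nil => exact ⟨⊥, by simp [Set.singleton_one]⟩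
  | cons i l ih =>
    obtain ⟨H, hH, hle⟩ := ih
    have hc : Commute (P i : Set G) (H : Set G) := by
      rw [hH]
      refine Commute.list_prod_right _ _ fun s hs => ?_
      obtain ⟨j, -, rfl⟩ := List.mem_map.1 hs
      exact hcomm i j
    obtain ⟨L, hL⟩ := (P i).exists_coe_eq_mul_of_commute H hc
    refine ⟨L, by rw [hL, hH, List.map_cons, List.prod_cons], fun j hj x hx => ?_⟩
    rw [← SetLike.mem_coe, hL]
    rcases List.mem_cons.1 hj with rfl | hj
    · exact ⟨x, hx, 1, H.one_mem, mul_one x⟩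
    · exact ⟨1, (P i).one_mem, x, hle j hj hx, one_mul x⟩

/-- Let `G` be a finite solvable group whose order has prime factorization
`n = ∏ᵢ pᵢ^eᵢ`, and let `{Pᵢ}` be a Sylow basis of `G`. Then every `x ∈ G` is
uniquely expressible as a product `x = x₁ x₂ ⋯ x_ℓ` with `xᵢ ∈ Pᵢ` for each `i`. -/
theorem sylow_basis_unique_factorization {G : Type*} [Group G] [Fintype G]
    (ℓ : ℕ) (p e : Fin ℓ → ℕ)
    (hprime : ∀ i, (p i).Prime)
    (hdistinct : Function.Injective p)
    (hepos : ∀ i, 0 < e i)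
    (hcard : Fintype.card G = ∏ i, p i ^ e i)
    (hsolv : IsSolvable G)
    (P : Fin ℓ → Subgroup G)
    (hP : ∀ i, Nat.card (P i) = p i ^ e i)
    (hcomm : ∀ i j, (P i : Set G) * (P j : Set G) = (P j : Set G) * (P i : Set G)) :
    ∀ x : G, ∃! f : Fin ℓ → G,
      (∀ i, f i ∈ P i) ∧ ((List.finRange ℓ).map f).prod = x := by
  have hcard' : Nat.card G = ∏ i, p i ^ e i := by rw [Nat.card_eq_fintype_card, hcard]
  obtain ⟨H, hH, hle⟩ := Subgroup.exists_coe_eq_list_prod_of_commute P hcomm (List.finRange ℓ)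
  have htop : H = ⊤ := by
    refine Subgroup.eq_top_of_card_eq H (Nat.dvd_antisymm H.card_subgroup_dvd_card ?_)
    rw [hcard']
    refine Fintype.prod_dvd_of_isRelPrime (fun i j hij => ?_) fun i => ?_
    · exact Nat.coprime_iff_isRelPrime.1 <| Nat.Coprime.pow _ _ <|
        (Nat.coprime_primes (hprime i) (hprime j)).2 (hdistinct.ne hij)
    · rw [← hP i]
      exact Subgroup.card_dvd_of_le (hle i (List.mem_finRange i))
  let φ : (∀ i, P i) → G := fun f => (List.ofFn fun i => (f i : G)).prod
  have hsurj : Function.Surjective φ := by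
    intro x
    have hx : x ∈ (H : Set G) := by simp [htop]
    rwa [hH, ← List.ofFn_eq_map, Set.mem_prod_list_ofFn] at hx
  have hbij : Function.Bijective φ := by
    refine (Nat.bijective_iff_surjective_and_card φ).2 ⟨hsurj, ?_⟩
    rw [Nat.card_pi, hcard']
    exact Finset.prod_congr rfl fun i _ => hP i
  intro x
  obtain ⟨f, hf, huniq⟩ := hbij.existsUnique x
  refine ⟨fun i => f i, ⟨fun i => (f i).2, ?_⟩, ?_⟩
  · rw [← List.ofFn_eq_map]
    exact hf
  · rintro g ⟨hg, hgx⟩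
    rw [← List.ofFn_eq_map] at hgx
    have := huniq (fun i => ⟨g i, hg i⟩) hgx
    funext i
    exact congrArg Subtype.val (congrFun this i)
end

section
/- Let G and H be isomorphic finite solvable groups whose common order has the prime factorization n = ∏_{i=1}^ℓ pᵢ^{eᵢ}. If {Pᵢ : 1 ≤ i ≤ ℓ} and {Qᵢ : 1 ≤ i ≤ ℓ} are Sylow bases of G and H respectively (with Pᵢ and Qᵢ Sylow pᵢ-subgroups), then there exists an isomorphism φ : G → H such that φ[Pᵢ] = Qᵢ for every i. -/
open Pointwise

namespace Subgroup

variable {G : Type*} [Group G]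

theorem coe_sup_of_commute {A B : Subgroup G} (h : Commute (A : Set G) (B : Set G)) :
    ((A ⊔ B : Subgroup G) : Set G) = A * B := by
  refine Set.Subset.antisymm ?_ (sup_eq_closure_mul A B ▸ subset_closure)
  let C : Subgroup G :=
    { carrier := A * B
      one_mem' := ⟨1, A.one_mem, 1, B.one_mem, mul_one 1⟩
      mul_mem' := fun {x y} hx hy ↦ by
        have hxy : x * y ∈ (A * B : Set G) * (A * B) := Set.mul_mem_mul hx hy
        rwa [mul_assoc, ← mul_assoc (B : Set G), ← h.eq, mul_assoc, coe_mul_coe, ← mul_assoc,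
          coe_mul_coe] at hxy
      inv_mem' := fun {x} hx ↦ by
        have hx' : x⁻¹ ∈ ((A * B : Set G))⁻¹ := Set.inv_mem_inv.mpr hx
        rwa [mul_inv_rev, inv_coe_set, inv_coe_set, ← h.eq] at hx' }
  exact (sup_le (fun a ha ↦ ⟨a, ha, 1, B.one_mem, mul_one a⟩)
    (fun b hb ↦ ⟨1, A.one_mem, b, hb, one_mul b⟩) : A ⊔ B ≤ C)

theorem card_sup_dvd_of_commute {A B : Subgroup G} (h : Commute (A : Set G) (B : Set G)) :
    Nat.card (A ⊔ B : Subgroup G) ∣ Nat.card A * Nat.card B := by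
  have himage : ((A : Set G).image (↑) : Set (G ⧸ B)) = MulAction.orbit A ((1 : G) : G ⧸ B) := by
    ext x
    constructor
    · rintro ⟨a, ha, rfl⟩
      exact ⟨⟨a, ha⟩, congrArg ((↑) : G → G ⧸ B) (mul_one a)⟩
    · rintro ⟨a, rfl⟩
      exact ⟨a, a.2, congrArg ((↑) : G → G ⧸ B) (mul_one (a : G)).symm⟩
  have hcard : Nat.card (A ⊔ B : Subgroup G) = Nat.card ((A * B : Set G)) := by
    rw [← coe_sup_of_commute h]
    rfl
  rw [hcard, card_mul_eq_card_subgroup_mul_card_quotient, himage, Nat.card_coe_set_eq,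
    ← MulAction.index_stabilizer, mul_comm]
  exact Nat.mul_dvd_mul_right (index_dvd_card _) _

theorem commute_finset_sup {ι : Type*} {A : Subgroup G} {P : ι → Subgroup G} (s : Finset ι)
    (hA : ∀ i ∈ s, Commute (A : Set G) (P i : Set G))
    (hP : ∀ i j, Commute (P i : Set G) (P j : Set G)) :
    Commute (A : Set G) (s.sup P : Subgroup G) := by
  classical
  induction s using Finset.induction_on generalizing A with
  | empty => exact set_mul_normal_comm (A : Set G) ⊥
  | insert i s _ ih =>
    rw [Finset.sup_insert, coe_sup_of_commute (ih fun j _ ↦ hP i j)]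
    exact (hA i (s.mem_insert_self i)).mul_right
      (ih fun j hj ↦ hA j (Finset.mem_insert_of_mem hj))

theorem card_finset_sup_dvd {ι : Type*} {P : ι → Subgroup G} (s : Finset ι)
    (hP : ∀ i j, Commute (P i : Set G) (P j : Set G)) :
    Nat.card (s.sup P : Subgroup G) ∣ ∏ i ∈ s, Nat.card (P i) := by
  classical
  induction s using Finset.induction_on with
  | empty => simp
  | insert i s his ih =>
    rw [Finset.sup_insert, Finset.prod_insert his]
    exact (card_sup_dvd_of_commute (commute_finset_sup s (fun j _ ↦ hP i j) hP)).trans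
      (Nat.mul_dvd_mul_left _ ih)

/-- The class in `N.QuotientDiff` of a complement of `N`. -/
def QuotientDiff.mk {N K : Subgroup G} [FiniteIndex N] [IsMulCommutative N]
    (hK : IsComplement' K N) : N.QuotientDiff :=
  Quotient.mk _ (⟨K, hK⟩ : N.LeftTransversal)

theorem stabilizer_quotientDiff_mk {N K : Subgroup G} [Finite G] [N.Normal] [IsMulCommutative N]
    (hN : Nat.Coprime (Nat.card N) N.index) (hK : IsComplement' K N) :
    MulAction.stabilizer G (QuotientDiff.mk hK) = K := by
  symm
  refine eq_of_le_of_card_ge (fun k hk ↦ ?_) ?_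
  · refine congrArg (Quotient.mk _) (Subtype.ext ?_)
    change MulOpposite.op k⁻¹ • (K : Set G) = K
    exact op_smul_coe_set (K.inv_mem hk)
  · have h₁ := (isComplement'_stabilizer_of_coprime hN
      (α := QuotientDiff.mk hK)).card_mul_card
    have h₂ := hK.card_mul_card
    rw [mul_comm, ← h₁] at h₂
    exact (Nat.eq_of_mul_eq_mul_left Nat.card_pos h₂).ge

/-- Complements of an abelian normal Hall subgroup are conjugate. -/
theorem IsComplement'.exists_map_conj_eq {N K L : Subgroup G} [Finite G] [N.Normal]
    [IsMulCommutative N] (hN : Nat.Coprime (Nat.card N) N.index)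
    (hK : IsComplement' K N) (hL : IsComplement' L N) :
    ∃ x ∈ N, K.map (MulAut.conj x).toMonoidHom = L := by
  obtain ⟨x, hx⟩ := exists_smul_eq hN
    (QuotientDiff.mk hK) (QuotientDiff.mk hL)
  refine ⟨x, x.2, ?_⟩
  rw [← stabilizer_quotientDiff_mk hN hL, ← hx]
  refine Eq.trans ?_ (MulAction.stabilizer_smul_eq_stabilizer_map_conj (x : G) _).symm
  rw [stabilizer_quotientDiff_mk hN hK]

theorem isComplement'_subgroupOf_sup {N K : Subgroup G} [N.Normal] (h : K ⊓ N = ⊥) :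
    IsComplement' (K.subgroupOf (K ⊔ N)) (N.subgroupOf (K ⊔ N)) := by
  apply isComplement'_of_disjoint_and_mul_eq_univ
  · rw [disjoint_iff, subgroupOf, subgroupOf, ← comap_inf, h]
    exact bot_subgroupOf _
  · rw [← mul_normal, ← subgroupOf_sup le_sup_left le_sup_right, subgroupOf_self, coe_top]

theorem exists_map_conj_eq_of_sup_eq {N K L : Subgroup G} [Finite G] [N.Normal]
    [IsMulCommutative N] (hK : (Nat.card K).Coprime (Nat.card N))
    (hL : (Nat.card L).Coprime (Nat.card N)) (h : K ⊔ N = L ⊔ N) :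
    ∃ x ∈ N, K.map (MulAut.conj x).toMonoidHom = L := by
  have hKc := isComplement'_subgroupOf_sup (disjoint_of_coprime_natCard hK).eq_bot
  have hLc := isComplement'_subgroupOf_sup (disjoint_of_coprime_natCard hL).eq_bot
  rw [← h] at hLc
  have hcop : Nat.Coprime (Nat.card (N.subgroupOf (K ⊔ N))) (N.subgroupOf (K ⊔ N)).index := by
    rw [hKc.index_eq_card,
      Nat.card_congr (subgroupOfEquivOfLe (le_sup_left : K ≤ K ⊔ N)).toEquiv,
      Nat.card_congr (subgroupOfEquivOfLe (le_sup_right : N ≤ K ⊔ N)).toEquiv]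
    exact hK.symm
  obtain ⟨x, hxN, hx⟩ := hKc.exists_map_conj_eq hcop hLc
  refine ⟨x, hxN, ?_⟩
  have hmap := congrArg (map (K ⊔ N).subtype) hx
  rw [map_map, subgroupOf_map_subtype, inf_eq_left.mpr (h ▸ le_sup_left)] at hmap
  rw [← hmap]
  have hKmap : (K.subgroupOf (K ⊔ N)).map (K ⊔ N).subtype = K := by
    rw [subgroupOf_map_subtype, inf_eq_left.mpr le_sup_left]
  refine (congrArg (map (MulAut.conj (x : G)).toMonoidHom) hKmap).symm.trans ?_
  rw [map_map]
  rfl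

theorem le_of_le_sup_of_inf_eq_bot {N L A B : Subgroup G} [N.Normal] (hA : A ≤ L) (hB : B ≤ L)
    (hL : L ⊓ N = ⊥) (h : A ≤ B ⊔ N) : A ≤ B := by
  intro a ha
  obtain ⟨b, hb, n, hn, rfl⟩ := mem_sup_of_normal_right.mp (h ha)
  have hnL : n ∈ L ⊓ N := ⟨(L.mul_mem_cancel_left (hB hb)).mp (hA ha), hn⟩
  rw [hL, mem_bot] at hnL
  simpa [hnL] using hb

end Subgroup

theorem Group.IsSolvable.exists_normal_isMulCommutative_isPGroup (G : Type*) [Group G] [Finite G]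
    [Nontrivial G] [Group.IsSolvable G] :
    ∃ (q : ℕ) (N : Subgroup G), q.Prime ∧ N.Normal ∧ IsMulCommutative N ∧ IsPGroup q N ∧
      N ≠ ⊥ := by
  classical
  obtain ⟨n, hn, hn'⟩ : ∃ n, derivedSeries G n ≠ ⊥ ∧ derivedSeries G (n + 1) = ⊥ := by
    have h := Group.IsSolvable.solvable (G := G)
    have hpos : Nat.find h ≠ 0 := fun h0 ↦ by
      have := Nat.find_spec h
      rw [h0, derivedSeries_zero] at this
      exact top_ne_bot this
    obtain ⟨n, hn⟩ := Nat.exists_eq_succ_of_ne_zero hpos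
    have hspec := Nat.find_spec h
    rw [hn] at hspec
    exact ⟨n, Nat.find_min h (by lia), hspec⟩
  rw [derivedSeries_succ, Subgroup.commutator_eq_bot_iff_le_centralizer,
    Subgroup.le_centralizer_iff_isMulCommutative] at hn'
  let A := derivedSeries G n
  have hA : IsMulCommutative A := hn'
  have hq := Nat.minFac_prime (A.one_lt_card_iff_ne_bot.mpr hn).ne'
  have := Fact.mk hq
  let P : Sylow (Nat.card A).minFac A := default
  have hPnormal : (P : Subgroup A).Normal :=
    ⟨fun a ha g ↦ by rwa [mul_comm' g a, mul_inv_cancel_right]⟩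
  have := P.unique_of_normal hPnormal
  refine ⟨_, (P : Subgroup A).map A.subtype, hq, inferInstance, inferInstance, P.2.map _, ?_⟩
  rw [Ne, (P : Subgroup A).map_eq_bot_iff_of_injective A.subtype_injective]
  exact P.ne_bot_of_dvd_card (Nat.minFac_dvd _)

namespace Sylow

variable {G : Type*} [Group G] [Finite G]

theorem coprime_card_finset_sup {ι : Type*} {p : ι → ℕ} [∀ i, Fact (p i).Prime]
    (P : ∀ i, Sylow (p i) G) (hP : ∀ i j, Commute (P i : Set G) (P j : Set G)) {q : ℕ}
    (hq : q.Prime) {N : Subgroup G} (hN : IsPGroup q N) (s : Finset ι) (hs : ∀ i ∈ s, p i ≠ q) :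
    (Nat.card (s.sup fun i ↦ (P i : Subgroup G) : Subgroup G)).Coprime (Nat.card N) := by
  have := Fact.mk hq
  refine Nat.Coprime.coprime_dvd_left (Subgroup.card_finset_sup_dvd s hP) ?_
  exact Nat.Coprime.prod_left fun i hi ↦
    IsPGroup.coprime_card_of_ne _ _ (hs i hi) _ _ (P i).2 hN

theorem exists_map_conj_eq_of_sup_eq {ι : Type*} [Fintype ι] {p : ι → ℕ}
    [∀ i, Fact (p i).Prime] (P Q : ∀ i, Sylow (p i) G)
    (hP : ∀ i j, Commute (P i : Set G) (P j : Set G))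
    (hQ : ∀ i j, Commute (Q i : Set G) (Q j : Set G)) {q : ℕ} (hq : q.Prime)
    {N : Subgroup G} [N.Normal] [IsMulCommutative N] (hN : IsPGroup q N)
    (h : ∀ i, (P i : Subgroup G) ⊔ N = (Q i : Subgroup G) ⊔ N) :
    ∃ x : G, ∀ i, (P i : Subgroup G).map (MulAut.conj x).toMonoidHom = Q i := by
  classical
  let s : Finset ι := Finset.univ.filter fun i ↦ p i ≠ q
  have hs : ∀ i ∈ s, p i ≠ q := fun i hi ↦ (Finset.mem_filter.mp hi).2
  have hLcop := coprime_card_finset_sup Q hQ hq hN s hs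
  have hsup : (s.sup fun i ↦ (P i : Subgroup G)) ⊔ N = (s.sup fun i ↦ (Q i : Subgroup G)) ⊔ N := by
    apply le_antisymm <;> refine sup_le (Finset.sup_le fun i hi ↦ ?_) le_sup_right
    · exact le_sup_left.trans ((h i).le.trans
        (sup_le_sup_right (Finset.le_sup (f := fun i ↦ (Q i : Subgroup G)) hi) N))
    · exact le_sup_left.trans ((h i).ge.trans
        (sup_le_sup_right (Finset.le_sup (f := fun i ↦ (P i : Subgroup G)) hi) N))
  obtain ⟨x, hxN, hx⟩ := Subgroup.exists_map_conj_eq_of_sup_eq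
    (coprime_card_finset_sup P hP hq hN s hs) hLcop hsup
  refine ⟨x, fun i ↦ ?_⟩
  have hle : (P i : Subgroup G).map (MulAut.conj x).toMonoidHom ≤ Q i := by
    by_cases hi : p i = q
    · have hNP : N ≤ P i := IsPGroup.le_sylow_of_normal (hi ▸ hN) (P i)
      have hNQ : N ≤ Q i := IsPGroup.le_sylow_of_normal (hi ▸ hN) (Q i)
      have hPQ := h i
      rw [sup_eq_left.mpr hNP, sup_eq_left.mpr hNQ] at hPQ
      rw [hPQ]
      rintro _ ⟨y, hy, rfl⟩
      exact mul_mem (mul_mem (hNQ hxN) hy) (inv_mem (hNQ hxN))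
    · have his : i ∈ s := by simp [s, hi]
      refine Subgroup.le_of_le_sup_of_inf_eq_bot (N := N) ?_
        (Finset.le_sup (f := fun i ↦ (Q i : Subgroup G)) his)
        (Subgroup.disjoint_of_coprime_natCard hLcop).eq_bot ?_
      · rw [← hx]
        exact Subgroup.map_mono (Finset.le_sup (f := fun i ↦ (P i : Subgroup G)) his)
      · rintro _ ⟨y, hy, rfl⟩
        have hyQ : y ∈ (Q i : Subgroup G) ⊔ N := h i ▸ Subgroup.mem_sup_left hy
        have hxQ : x ∈ (Q i : Subgroup G) ⊔ N := Subgroup.mem_sup_right hxN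
        exact mul_mem (mul_mem hxQ hyQ) (inv_mem hxQ)
  exact (((P i).mapSurjective (MulAut.conj x).surjective).is_maximal' (Q i).2 hle).symm

/-- **Hall's theorem**: any two Sylow bases of a finite solvable group are conjugate. -/
theorem exists_map_conj_eq_of_commute {G : Type*} [Group G] [Finite G] [Group.IsSolvable G]
    {ι : Type*} [Fintype ι] {p : ι → ℕ} [∀ i, Fact (p i).Prime] (P Q : ∀ i, Sylow (p i) G)
    (hP : ∀ i j, Commute (P i : Set G) (P j : Set G))
    (hQ : ∀ i j, Commute (Q i : Set G) (Q j : Set G)) :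
    ∃ x : G, ∀ i, (P i : Subgroup G).map (MulAut.conj x).toMonoidHom = Q i := by
  induction hn : Nat.card G using Nat.strong_induction_on generalizing G with
  | _ n ih =>
  subst hn
  cases subsingleton_or_nontrivial G with
  | inl _ => exact ⟨1, fun i ↦ Subsingleton.elim _ _⟩
  | inr _ =>
  obtain ⟨q, N, hq, _, _, hN, hNbot⟩ := Group.IsSolvable.exists_normal_isMulCommutative_isPGroup G
  have hcomm {R : ∀ i, Sylow (p i) G} (hR : ∀ i j, Commute (R i : Set G) (R j : Set G))
      {G' : Type _} [Group G'] {f : G →* G'} (hf : Function.Surjective f) (i j : ι) :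
      Commute ((R i).mapSurjective hf : Set G') ((R j).mapSurjective hf : Set G') := by
    have := congrArg (Set.image f) (hR i j).eq
    rwa [Set.image_mul, Set.image_mul] at this
  have hlt : Nat.card (G ⧸ N) < Nat.card G := by
    rw [N.card_eq_card_quotient_mul_card_subgroup]
    exact lt_mul_of_one_lt_right Nat.card_pos (N.one_lt_card_iff_ne_bot.mpr hNbot)
  have hπ := QuotientGroup.mk'_surjective N
  obtain ⟨y, hy⟩ := ih _ hlt (fun i ↦ (P i).mapSurjective hπ) (fun i ↦ (Q i).mapSurjective hπ)
    (hcomm hP hπ) (hcomm hQ hπ) rfl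
  obtain ⟨g, rfl⟩ := hπ y
  have hg : Function.Surjective (MulAut.conj g).toMonoidHom := (MulAut.conj g).surjective
  obtain ⟨x, hx⟩ := exists_map_conj_eq_of_sup_eq (fun i ↦ (P i).mapSurjective hg) Q
    (hcomm hP hg) hQ hq hN fun i ↦ by
      have hmap : ((P i : Subgroup G).map (MulAut.conj g).toMonoidHom).map (QuotientGroup.mk' N) =
          (Q i : Subgroup G).map (QuotientGroup.mk' N) := by
        rw [← coe_mapSurjective hπ (Q i), ← hy i, coe_mapSurjective, Subgroup.map_map,
          Subgroup.map_map]
        congr 1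
      rwa [Subgroup.map_eq_map_iff, QuotientGroup.ker_mk'] at hmap
  refine ⟨x * g, fun i ↦ ?_⟩
  rw [← hx i, coe_mapSurjective, Subgroup.map_map, map_mul]
  rfl

end Sylow

/-- Let `G` and `H` be isomorphic finite solvable groups of common order
`n = ∏ᵢ pᵢ^eᵢ`. If `{Pᵢ}` and `{Qᵢ}` are Sylow bases of `G` and `H` respectively
(with `Pᵢ`, `Qᵢ` Sylow `pᵢ`-subgroups), then there exists an isomorphism
`φ : G → H` such that `φ[Pᵢ] = Qᵢ` for every `i`. -/
theorem sylow_bases_respected_by_some_iso {G H : Type*} [Group G] [Group H]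
    [Fintype G] [Fintype H]
    (ℓ : ℕ) (p e : Fin ℓ → ℕ)
    (hprime : ∀ i, (p i).Prime)
    (hdistinct : Function.Injective p)
    (hepos : ∀ i, 0 < e i)
    (hcardG : Fintype.card G = ∏ i, p i ^ e i)
    (hcardH : Fintype.card H = ∏ i, p i ^ e i)
    (hsolvG : IsSolvable G) (hsolvH : IsSolvable H)
    (hiso : Nonempty (G ≃* H))
    (P : Fin ℓ → Subgroup G) (Q : Fin ℓ → Subgroup H)
    (hP : ∀ i, Nat.card (P i) = p i ^ e i)
    (hQ : ∀ i, Nat.card (Q i) = p i ^ e i)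
    (hPcomm : ∀ i j, (P i : Set G) * (P j : Set G) = (P j : Set G) * (P i : Set G))
    (hQcomm : ∀ i j, (Q i : Set H) * (Q j : Set H) = (Q j : Set H) * (Q i : Set H)) :
    ∃ φ : G ≃* H, ∀ i, (P i).map φ.toMonoidHom = Q i := by
  have : Group.IsSolvable H := hsolvH
  have (i : Fin ℓ) : Fact (p i).Prime := ⟨hprime i⟩
  have hfact (i : Fin ℓ) : (Nat.card H).factorization (p i) = e i := by
    rw [Nat.card_eq_fintype_card, hcardH,
      Nat.factorization_prod fun j _ ↦ pow_ne_zero _ (hprime j).ne_zero, Finset.sum_apply']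
    rw [Finset.sum_eq_single i]
    · simp [(hprime i).factorization_self]
    · intro j _ hji
      simp [(hprime j).factorization, hdistinct.ne hji]
    · simp
  obtain ⟨ψ⟩ := hiso
  have hPcard (i : Fin ℓ) : Nat.card ((P i).map ψ.toMonoidHom) = p i ^ e i := by
    rw [← hP i]
    exact Nat.card_congr (ψ.subgroupMap (P i)).toEquiv.symm
  obtain ⟨x, hx⟩ := Sylow.exists_map_conj_eq_of_commute
    (fun i ↦ Sylow.ofCard ((P i).map ψ.toMonoidHom) (by rw [hPcard, hfact]))
    (fun i ↦ Sylow.ofCard (Q i) (by rw [hQ, hfact]))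
    (fun i j ↦ by
      have := congrArg (Set.image ψ) (hPcomm i j)
      rwa [Set.image_mul, Set.image_mul] at this) hQcomm
  refine ⟨ψ.trans (MulAut.conj x), fun i ↦ ?_⟩
  refine Eq.trans ?_ (hx i)
  rw [Sylow.coe_ofCard, Subgroup.map_map]
  rfl
end
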